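/- arXiv:2405.00405 — 2 statements merged into one kernel-verified Lean document; each statement's English description precedes it below -/
import Mathlib

section
/- Fix x₀ ∈ ℝ and λ ∈ (0,1), assume ρ is quasi-pure at x₀, let M = Π_k(x₀) + √λ · Π_r(x₀), and let σ(y) = M ρ(y) M / Tr[M ρ(y) M]. If L is any SLD of ρ at x₀, then L/√λ is an SLD of σ at x₀, and the success probability p = Tr[M ρ(x₀) M] = λ satisfies p · Tr[σ(x₀) (L/√λ)²] = Tr[ρ(x₀) L²]; that is, the postselection is lossless: the postselected quantum Fisher information weighted by the success probability equals the quantum Fisher information of ρ at x₀. -/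
open Matrix
open scoped Classical

/-- The rank-one matrix `|v⟩⟨w|`, sending `u` to `⟨w, u⟩ v`. -/
noncomputable def ketbra {n : Type*} (v w : n → ℂ) : Matrix n n ℂ :=
  Matrix.vecMulVec v (star w)

lemma ketbra_mul_mul_ketbra {n : Type*} [Fintype n] (u v w z : n → ℂ) (A : Matrix n n ℂ) :
    ketbra u v * A * ketbra w z = (star v ⬝ᵥ (A *ᵥ w)) • ketbra u z := by
  rw [ketbra, ketbra, ketbra, Matrix.mul_assoc, mul_vecMulVec, vecMulVec_mul_vecMulVec,
    vecMulVec_smul]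

lemma ketbra_mul_ketbra {n : Type*} [Fintype n] (u v w z : n → ℂ) :
    ketbra u v * ketbra w z = (star v ⬝ᵥ w) • ketbra u z := by
  rw [ketbra, ketbra, ketbra, vecMulVec_mul_vecMulVec, vecMulVec_smul]

lemma trace_ketbra {n : Type*} [Fintype n] (u v : n → ℂ) :
    (ketbra u v).trace = star v ⬝ᵥ u := by
  rw [ketbra, trace_vecMulVec, dotProduct_comm]

section SpectralForm

variable {n ι : Type*} [Fintype n] [Fintype ι] {φ : ι → n → ℂ}

lemma sum_ketbra_mul_mul_sum_ketbra_eq_zero {A : Matrix n n ℂ}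
    (hA : ∀ k l, star (φ k) ⬝ᵥ (A *ᵥ φ l) = 0) :
    (∑ k, ketbra (φ k) (φ k)) * A * ∑ l, ketbra (φ l) (φ l) = 0 := by
  simp [Finset.sum_mul, Finset.mul_sum, ketbra_mul_mul_ketbra, hA]

variable [DecidableEq ι]

lemma sum_ketbra_mul_sum_smul_ketbra
    (hφ : ∀ k l, star (φ k) ⬝ᵥ φ l = if k = l then 1 else 0) (q : ι → ℂ) :
    (∑ k, ketbra (φ k) (φ k)) * ∑ l, q l • ketbra (φ l) (φ l) =
      ∑ l, q l • ketbra (φ l) (φ l) := by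
  simp [Finset.sum_mul, Finset.mul_sum, ketbra_mul_ketbra, hφ]

lemma sum_smul_ketbra_mul_sum_ketbra
    (hφ : ∀ k l, star (φ k) ⬝ᵥ φ l = if k = l then 1 else 0) (q : ι → ℂ) :
    (∑ l, q l • ketbra (φ l) (φ l)) * (∑ k, ketbra (φ k) (φ k)) =
      ∑ l, q l • ketbra (φ l) (φ l) := by
  simp [Finset.sum_mul, Finset.mul_sum, ketbra_mul_ketbra, hφ]

lemma trace_sum_smul_ketbra
    (hφ : ∀ k l, star (φ k) ⬝ᵥ φ l = if k = l then 1 else 0) (q : ι → ℂ) :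
    (∑ l, q l • ketbra (φ l) (φ l)).trace = ∑ l, q l := by
  simp [trace_sum, trace_ketbra, hφ]

end SpectralForm

lemma HasDerivAt.matrix_mul_mul_apply {n : Type*} [Fintype n] {ρ : ℝ → Matrix n n ℂ}
    {ρ' : Matrix n n ℂ} {x : ℝ} (hρ : ∀ i j, HasDerivAt (fun y => ρ y i j) (ρ' i j) x)
    (A B : Matrix n n ℂ) (i j : n) :
    HasDerivAt (fun y => (A * ρ y * B) i j) ((A * ρ' * B) i j) x := by
  simp only [mul_apply]
  exact HasDerivAt.fun_sum fun k _ =>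
    (HasDerivAt.fun_sum fun l _ => (hρ l k).const_mul (A i l)).mul_const (B k j)

/-- A matrix whose diagonal blocks with respect to the idempotent `P` both vanish is rescaled by
`s` under two-sided multiplication by `(1 - P) + s P`. -/
lemma attenuation_mul_mul_attenuation {n : Type*} [Fintype n] [DecidableEq n]
    {P A : Matrix n n ℂ} (hP : P * A * P = 0) (hQ : (1 - P) * A * (1 - P) = 0) (s : ℂ) :
    (1 - P + s • P) * A * (1 - P + s • P) = s • A := by
  have hA : A = P * A + A * P := by
    rw [sub_mul, one_mul, mul_sub, mul_one, sub_mul, hP, sub_zero, sub_sub] at hQ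
    exact sub_eq_zero.mp hQ
  calc (1 - P + s • P) * A * (1 - P + s • P)
      = A + (s - 1) • (P * A + A * P) + ((s - 1) ^ 2) • (P * A * P) := by
        simp only [add_mul, mul_add, sub_mul, mul_sub, one_mul, mul_one, Matrix.smul_mul,
          Matrix.mul_smul, smul_add, smul_smul]
        module
    _ = s • A := by
        rw [← hA, hP]
        module

lemma trace_eq_zero_of_blocks_eq_zero {n : Type*} [Fintype n] [DecidableEq n]
    {P A : Matrix n n ℂ} (hPP : P * P = P) (hP : P * A * P = 0)
    (hQ : (1 - P) * A * (1 - P) = 0) : A.trace = 0 := by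
  have h1 : (P * A).trace = 0 := by
    rw [← hPP, Matrix.mul_assoc, trace_mul_comm, hP, trace_zero]
  have h2 : ((1 - P) * A).trace = 0 := by
    have hQQ : (1 - P) * (1 - P) = 1 - P := by
      simp [sub_mul, mul_sub, hPP]
    rw [← hQQ, Matrix.mul_assoc, trace_mul_comm, hQ, trace_zero]
  simpa [sub_mul, h1] using h2

/-- For a quasi-pure family at `x₀`, with `M = Π_k(x₀) + √λ Π_r(x₀)` and
`σ(y) = M ρ(y) M / Tr[M ρ(y) M]`: if `L` is any SLD of `ρ` at `x₀`, then `L/√λ` is an SLD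
of `σ` at `x₀`, and the success probability `p = Tr[M ρ(x₀) M] = λ` satisfies
`p · Tr[σ(x₀) (L/√λ)²] = Tr[ρ(x₀) L²]` (lossless postselection). -/
theorem lossless_postselection_of_quasiPure
    {d r : ℕ}
    (ρ : ℝ → Matrix (Fin d) (Fin d) ℂ)
    (q : Fin r → ℝ → ℝ) (φ : Fin r → ℝ → Fin d → ℂ)
    (hortho : ∀ x m n, star (φ m x) ⬝ᵥ φ n x = if m = n then 1 else 0)
    (hqpos : ∀ x n, 0 < q n x)
    (hqsum : ∀ x, ∑ n, q n x = 1)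
    (hspec : ∀ x, ρ x = ∑ n, (q n x : ℂ) • ketbra (φ n x) (φ n x))
    (x₀ : ℝ)
    (q' : Fin r → ℝ) (hq' : ∀ n, HasDerivAt (q n) (q' n) x₀)
    (φ' : Fin r → Fin d → ℂ)
    (hφ' : ∀ n i, HasDerivAt (fun y => φ n y i) (φ' n i) x₀)
    (ρ' : Matrix (Fin d) (Fin d) ℂ)
    (hρ' : ∀ i j, HasDerivAt (fun y => ρ y i j) (ρ' i j) x₀)
    (hquasipure : ∀ k l, star (φ k x₀) ⬝ᵥ (ρ' *ᵥ φ l x₀) = 0)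
    (lam : ℝ) (hlam : lam ∈ Set.Ioo (0 : ℝ) 1)
    (Pr Pk M : Matrix (Fin d) (Fin d) ℂ)
    (hPr : Pr = ∑ n, ketbra (φ n x₀) (φ n x₀))
    (hPk : Pk = 1 - Pr)
    (hM : M = Pk + (Real.sqrt lam : ℂ) • Pr)
    (σ : ℝ → Matrix (Fin d) (Fin d) ℂ)
    (hσ : ∀ y, σ y = ((M * ρ y * M).trace)⁻¹ • (M * ρ y * M))
    (L : Matrix (Fin d) (Fin d) ℂ)
    (hL : L.IsHermitian)
    (hSLD : ρ' = (1/2 : ℂ) • (L * ρ x₀ + ρ x₀ * L)) :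
    (M * ρ x₀ * M).trace = (lam : ℂ) ∧
    (((Real.sqrt lam : ℂ))⁻¹ • L).IsHermitian ∧
    (∀ i j, HasDerivAt (fun y => σ y i j)
      (((1/2 : ℂ) • ((((Real.sqrt lam : ℂ))⁻¹ • L) * σ x₀
        + σ x₀ * (((Real.sqrt lam : ℂ))⁻¹ • L))) i j) x₀) ∧
    (lam : ℂ) * (σ x₀ * (((Real.sqrt lam : ℂ))⁻¹ • L) ^ 2).trace = (ρ x₀ * L ^ 2).trace := by
  have hs : (Real.sqrt lam : ℂ) * Real.sqrt lam = lam := by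
    rw [← Complex.ofReal_mul, Real.mul_self_sqrt hlam.1.le]
  have hlam0 : (lam : ℂ) ≠ 0 := Complex.ofReal_ne_zero.mpr hlam.1.ne'
  set s : ℂ := (Real.sqrt lam : ℂ) with hs_def
  have hs0 : s ≠ 0 := fun h => hlam0 (by rw [← hs, h, zero_mul])
  have hPρ : Pr * ρ x₀ = ρ x₀ := by
    rw [hPr, hspec]
    exact sum_ketbra_mul_sum_smul_ketbra (fun m n => by simp [hortho]) _
  have hρP : ρ x₀ * Pr = ρ x₀ := by
    rw [hPr, hspec]
    exact sum_smul_ketbra_mul_sum_ketbra (fun m n => by simp [hortho]) _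
  have hPP : Pr * Pr = Pr := by
    simpa [← hPr] using sum_ketbra_mul_sum_smul_ketbra
      (φ := fun n => φ n x₀) (fun m n => by simp [hortho]) 1
  have htr : (ρ x₀).trace = 1 := by
    rw [hspec, trace_sum_smul_ketbra (fun m n => by simp [hortho]), ← Complex.ofReal_sum, hqsum,
      Complex.ofReal_one]
  have hP : Pr * ρ' * Pr = 0 := by
    rw [hPr]
    exact sum_ketbra_mul_mul_sum_ketbra_eq_zero hquasipure
  have hQρ : (1 - Pr) * ρ x₀ = 0 := by rw [sub_mul, one_mul, hPρ, sub_self]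
  have hρQ : ρ x₀ * (1 - Pr) = 0 := by rw [mul_sub, mul_one, hρP, sub_self]
  have hQ : (1 - Pr) * ρ' * (1 - Pr) = 0 := by
    rw [hSLD, Matrix.mul_smul, Matrix.smul_mul, mul_add, add_mul, ← Matrix.mul_assoc,
      Matrix.mul_assoc _ (ρ x₀) (1 - Pr), hρQ, ← Matrix.mul_assoc, hQρ]
    simp
  rw [hPk] at hM
  have hMρ : M * ρ x₀ * M = (lam : ℂ) • ρ x₀ := by
    rw [hM, add_mul, hQρ, Matrix.smul_mul, hPρ, zero_add, Matrix.smul_mul, mul_add, hρQ,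
      Matrix.mul_smul, hρP, zero_add, smul_smul, hs]
  have hMρ' : M * ρ' * M = s • ρ' := by
    rw [hM, attenuation_mul_mul_attenuation hP hQ]
  have hp : (M * ρ x₀ * M).trace = (lam : ℂ) := by
    rw [hMρ, trace_smul, htr, smul_eq_mul, mul_one]
  have hσ₀ : σ x₀ = ρ x₀ := by
    rw [hσ, hp, hMρ, smul_smul, inv_mul_cancel₀ hlam0, one_smul]
  refine ⟨hp, ?_, fun i j => ?_, ?_⟩
  · rw [IsHermitian, conjTranspose_smul, hL.eq]
    simp [hs_def]
  · have htrace : HasDerivAt (fun y => (M * ρ y * M).trace) 0 x₀ := by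
      have h : HasDerivAt (fun y => (M * ρ y * M).trace) (M * ρ' * M).trace x₀ :=
        HasDerivAt.fun_sum fun k _ => HasDerivAt.matrix_mul_mul_apply hρ' M M k k
      rwa [hMρ', trace_smul, trace_eq_zero_of_blocks_eq_zero hPP hP hQ, smul_zero] at h
    have h := (htrace.fun_inv (hp ▸ hlam0)).mul (HasDerivAt.matrix_mul_mul_apply hρ' M M i j)
    have hderiv : (1 / 2 : ℂ) • ((s⁻¹ • L) * σ x₀ + σ x₀ * (s⁻¹ • L)) = s⁻¹ • ρ' := by
      rw [hσ₀, hSLD, Matrix.smul_mul, Matrix.mul_smul, ← smul_add, smul_comm]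
    rw [hderiv]
    simp only [hσ]
    refine h.congr_deriv ?_
    rw [hp, hMρ', ← hs]
    simp only [Matrix.smul_apply, smul_eq_mul]
    field_simp
    ring
  · rw [hσ₀, smul_pow, Matrix.mul_smul, trace_smul, smul_eq_mul, ← mul_assoc, ← hs]
    field_simp
end

section
/- Assume ρ is quasi-pure at x. Then for every SLD L of ρ at x, the quantum Fisher information equals Tr[ρ(x) L²] = 4 Σ_{n=1}^{r} q_n(x) ‖𝒟φ_n(x)‖², where 𝒟φ_n(x) is the generalized covariant derivative. -/
open Matrix
open scoped Classical

theorem ketbra_mulVec {n : Type*} [Fintype n] (v w u : n → ℂ) :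
    ketbra v w *ᵥ u = (star w ⬝ᵥ u) • v := by
  ext i
  simp [ketbra, Matrix.vecMulVec_mulVec, mul_comm]

theorem sum_smul_ketbra_mulVec {n ι : Type*} [Fintype n] [Fintype ι] (c : ι → ℂ) (v : ι → n → ℂ)
    (u : n → ℂ) :
    (∑ m, c m • ketbra (v m) (v m)) *ᵥ u = ∑ m, (c m * (star (v m) ⬝ᵥ u)) • v m := by
  simp only [Matrix.sum_mulVec, Matrix.smul_mulVec, ketbra_mulVec, smul_smul]

theorem dotProduct_sum_smul_of_orthonormal {n ι : Type*} [Fintype n] [Fintype ι] [DecidableEq ι]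
    (v : ι → n → ℂ) (hv : ∀ k m, star (v k) ⬝ᵥ v m = if k = m then 1 else 0)
    (c : ι → ℂ) (k : ι) :
    star (v k) ⬝ᵥ (∑ m, c m • v m) = c k := by
  simp [dotProduct_sum, dotProduct_smul, hv]

theorem sum_smul_ketbra_mulVec_self {n ι : Type*} [Fintype n] [Fintype ι] [DecidableEq ι]
    (v : ι → n → ℂ) (hv : ∀ k m, star (v k) ⬝ᵥ v m = if k = m then 1 else 0)
    (c : ι → ℂ) (k : ι) :
    (∑ m, c m • ketbra (v m) (v m)) *ᵥ v k = c k • v k := by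
  simp [sum_smul_ketbra_mulVec, hv, ite_smul]

theorem trace_ketbra_mul {n : Type*} [Fintype n] (v w : n → ℂ) (A : Matrix n n ℂ) :
    (ketbra v w * A).trace = star w ⬝ᵥ (A *ᵥ v) := by
  rw [ketbra, Matrix.vecMulVec_mul, Matrix.trace_vecMulVec, dotProduct_comm,
    Matrix.dotProduct_mulVec]

/-- Differentiating the eigenvalue equation `ρ φ = q φ`. -/
theorem mulVec_deriv_eigenvector {n : Type*} [Fintype n] {ρ : ℝ → Matrix n n ℂ} {q : ℝ → ℝ}
    {φ : ℝ → n → ℂ} (hρφ : ∀ y, ρ y *ᵥ φ y = (q y : ℂ) • φ y) {x q' : ℝ} {φ' : n → ℂ}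
    {ρ' : Matrix n n ℂ} (hq' : HasDerivAt q q' x)
    (hφ' : ∀ i, HasDerivAt (fun y => φ y i) (φ' i) x)
    (hρ' : ∀ i j, HasDerivAt (fun y => ρ y i j) (ρ' i j) x) :
    ρ' *ᵥ φ x + ρ x *ᵥ φ' = (q' : ℂ) • φ x + (q x : ℂ) • φ' := by
  ext i
  have hleft : HasDerivAt (fun y => ∑ j, ρ y i j * φ y j)
      (∑ j, (ρ' i j * φ x j + ρ x i j * φ' j)) x :=
    HasDerivAt.fun_sum fun j _ => (hρ' i j).fun_mul (hφ' j)
  have hright : HasDerivAt (fun y => (q y : ℂ) * φ y i) ((q' : ℂ) * φ x i + (q x : ℂ) * φ' i) x :=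
    hq'.ofReal_comp.fun_mul (hφ' i)
  have heq : (fun y => ∑ j, ρ y i j * φ y j) = fun y => (q y : ℂ) * φ y i :=
    funext fun y => congrFun (hρφ y) i
  rw [heq] at hleft
  simpa [Matrix.mulVec, dotProduct, Finset.sum_add_distrib] using hleft.unique hright

/-- If `ρ(x) = ∑ₙ qₙ(x)|φₙ(x)⟩⟨φₙ(x)|` is quasi-pure at `x`, then for
every SLD `L` of `ρ` at `x`, the quantum Fisher information equals
`Tr[ρ(x) L²] = 4 ∑ₙ qₙ(x) ‖𝒟φₙ(x)‖²`, where `𝒟φₙ(x) = φₙ'(x) − Πₙ(x)φₙ'(x)` is the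
generalized covariant derivative. -/
theorem qfi_of_quasiPure
    {d r : ℕ}
    (ρ : ℝ → Matrix (Fin d) (Fin d) ℂ)
    (q : Fin r → ℝ → ℝ) (φ : Fin r → ℝ → Fin d → ℂ)
    (hortho : ∀ x m n, star (φ m x) ⬝ᵥ φ n x = if m = n then 1 else 0)
    (hqpos : ∀ x n, 0 < q n x)
    (hqsum : ∀ x, ∑ n, q n x = 1)
    (hspec : ∀ x, ρ x = ∑ n, (q n x : ℂ) • ketbra (φ n x) (φ n x))
    (x : ℝ)
    (q' : Fin r → ℝ) (hq' : ∀ n, HasDerivAt (q n) (q' n) x)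
    (φ' : Fin r → Fin d → ℂ)
    (hφ' : ∀ n i, HasDerivAt (fun y => φ n y i) (φ' n i) x)
    (ρ' : Matrix (Fin d) (Fin d) ℂ)
    (hρ' : ∀ i j, HasDerivAt (fun y => ρ y i j) (ρ' i j) x)
    (hquasipure : ∀ k l, star (φ k x) ⬝ᵥ (ρ' *ᵥ φ l x) = 0)
    (Dφ : Fin r → Fin d → ℂ)
    (hDφ : ∀ n, Dφ n = φ' n - ∑ m ∈ Finset.univ.filter (fun m => q m x = q n x),
        (star (φ m x) ⬝ᵥ φ' n) • φ m x)
    (L : Matrix (Fin d) (Fin d) ℂ)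
    (hL : L.IsHermitian)
    (hSLD : ρ' = (1/2 : ℂ) • (L * ρ x + ρ x * L)) :
    (ρ x * L ^ 2).trace = 4 * ∑ n, (q n x : ℂ) * (star (Dφ n) ⬝ᵥ Dφ n) := by
  have ho := hortho x
  have heig : ∀ n y, ρ y *ᵥ φ n y = (q n y : ℂ) • φ n y := fun n y => by
    rw [hspec y]
    exact sum_smul_ketbra_mulVec_self (fun m => φ m y) (hortho y) (fun m => (q m y : ℂ)) n
  have hρ : ∀ u, ρ x *ᵥ u = ∑ m, ((q m x : ℂ) * (star (φ m x) ⬝ᵥ u)) • φ m x := fun u => by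
    rw [hspec x, sum_smul_ketbra_mulVec]
  have hdotρ : ∀ k u, star (φ k x) ⬝ᵥ (ρ x *ᵥ u) = (q k x : ℂ) * (star (φ k x) ⬝ᵥ u) :=
    fun k u => by
      rw [hρ, dotProduct_sum_smul_of_orthonormal (fun m => φ m x) ho]
  have hSLDφ : ∀ n, ρ' *ᵥ φ n x =
      (1/2 : ℂ) • ((q n x : ℂ) • (L *ᵥ φ n x) + ρ x *ᵥ (L *ᵥ φ n x)) := fun n => by
    rw [hSLD, Matrix.smul_mulVec, Matrix.add_mulVec, ← Matrix.mulVec_mulVec,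
      ← Matrix.mulVec_mulVec, heig, Matrix.mulVec_smul]
  have hLzero : ∀ k n, star (φ k x) ⬝ᵥ (L *ᵥ φ n x) = 0 := fun k n => by
    have h := hquasipure k n
    rw [hSLDφ, dotProduct_smul, dotProduct_add, dotProduct_smul, hdotρ, smul_eq_mul,
      smul_eq_mul, ← add_mul] at h
    have hne : (q n x : ℂ) + q k x ≠ 0 := by
      exact_mod_cast (add_pos (hqpos x n) (hqpos x k)).ne'
    simpa [hne] using h
  have hρL : ∀ n, ρ x *ᵥ (L *ᵥ φ n x) = 0 := fun n => by
    simp [hρ, hLzero]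
  have hderiv : ∀ n, ρ' *ᵥ φ n x + ρ x *ᵥ φ' n = (q' n : ℂ) • φ n x + (q n x : ℂ) • φ' n :=
    fun n => mulVec_deriv_eigenvector (heig n) (hq' n) (hφ' n) hρ'
  have hcoeff : ∀ k n, (q k x : ℂ) * (star (φ k x) ⬝ᵥ φ' n) =
      (q' n : ℂ) * (if k = n then 1 else 0) + (q n x : ℂ) * (star (φ k x) ⬝ᵥ φ' n) :=
    fun k n => by
      have h := congrArg (star (φ k x) ⬝ᵥ ·) (hderiv n)
      simpa only [dotProduct_add, hquasipure, hdotρ, zero_add, dotProduct_smul, smul_eq_mul, ho]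
        using h
  have hq'zero : ∀ n, (q' n : ℂ) = 0 := fun n => by
    simpa using hcoeff n n
  have hperp : ∀ k n, q k x ≠ q n x → star (φ k x) ⬝ᵥ φ' n = 0 := fun k n hkn => by
    have h := hcoeff k n
    rw [hq'zero, zero_mul, zero_add] at h
    by_contra hne
    exact hkn (by exact_mod_cast mul_right_cancel₀ hne h)
  have hρφ' : ∀ n, ρ x *ᵥ φ' n = (q n x : ℂ) •
      ∑ m ∈ Finset.univ.filter (fun m => q m x = q n x), (star (φ m x) ⬝ᵥ φ' n) • φ m x :=
    fun n => by
      rw [hρ, Finset.sum_filter, Finset.smul_sum]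
      refine Finset.sum_congr rfl fun m _ => ?_
      split_ifs with h
      · rw [h, smul_smul]
      · rw [hperp m n h, mul_zero, zero_smul, smul_zero]
  have hLφ : ∀ n, L *ᵥ φ n x = (2 : ℂ) • Dφ n := fun n => by
    have hne : (q n x : ℂ) ≠ 0 := by exact_mod_cast (hqpos x n).ne'
    have h : (q n x : ℂ) • ((1/2 : ℂ) • (L *ᵥ φ n x)) = (q n x : ℂ) • Dφ n := by
      have h' := hderiv n
      rw [hρφ', hSLDφ, hρL, hq'zero, zero_smul, zero_add, add_zero] at h'
      rw [hDφ, smul_sub, ← h', add_sub_cancel_right, smul_comm]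
    rw [← smul_right_injective _ hne h, smul_smul]
    norm_num
  rw [hspec x, Finset.sum_mul, Matrix.trace_sum, Finset.mul_sum]
  refine Finset.sum_congr rfl fun n _ => ?_
  have hadj : star (φ n x) ᵥ* L = star (L *ᵥ φ n x) := by
    rw [Matrix.star_mulVec, hL.eq]
  rw [Matrix.smul_mul, Matrix.trace_smul, trace_ketbra_mul, pow_two, ← Matrix.mulVec_mulVec,
    Matrix.dotProduct_mulVec, hadj, hLφ, star_smul, smul_dotProduct, dotProduct_smul]
  simp only [smul_eq_mul, star_ofNat]
  ring
end
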